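/- In the graph L⁽¹⁾, the vertices x = w₁ and y = w₅ are not connected by a Hamilton path, i.e., there is no path in L⁽¹⁾ with endpoints w₁ and w₅ that contains every vertex of L⁽¹⁾. -/

import Mathlib

open SimpleGraph

/-- Number of connected components of the subgraph induced on the complement of `S`. -/
noncomputable def numComponents {V : Type} (G : SimpleGraph V) (S : Set V) : ℕ :=
  Nat.card (G.induce Sᶜ).ConnectedComponent

/-- `G` is `t`-tough: `|S| ≥ t · ω(G \ S)` for every vertex subset `S`
with `ω(G \ S) > 1`. -/
def IsTough {V : Type} (t : ℝ) (G : SimpleGraph V) : Prop :=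
  ∀ S : Finset V, 1 < numComponents G ↑S →
    t * (numComponents G ↑S : ℝ) ≤ (S.card : ℝ)

/-- The toughness of `G` equals `t`: `t` is the greatest nonnegative real
for which `G` is `t`-tough. -/
def HasToughness {V : Type} (G : SimpleGraph V) (t : ℝ) : Prop :=
  IsGreatest {s : ℝ | 0 ≤ s ∧ IsTough s G} t

/-- A Hamiltonian cycle: a cycle whose support contains every vertex. -/
def IsHamCycle {V : Type} {G : SimpleGraph V} {v : V} (p : G.Walk v v) : Prop :=
  p.IsCycle ∧ ∀ u, u ∈ p.support

/-- A graph is Hamiltonian if it contains a Hamiltonian cycle. -/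
def IsHam {V : Type} (G : SimpleGraph V) : Prop :=
  ∃ (v : V) (p : G.Walk v v), IsHamCycle p

/-- `x` and `y` are connected by a Hamilton path of `G`: a path with endpoints
`x` and `y` containing every vertex of `G`. -/
def HamConnected {V : Type} (G : SimpleGraph V) (x y : V) : Prop :=
  ∃ p : G.Walk x y, p.IsPath ∧ ∀ v, v ∈ p.support

/-- `L⁽¹⁾`: the 8-cycle `w₁w₂…w₈w₁` (here `wᵢ = i - 1`) together with the
edges `w₂w₄, w₄w₆, w₆w₈, w₂w₈`; `x = w₁ = 0`, `y = w₅ = 4`. -/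
def L1 : SimpleGraph (Fin 8) := SimpleGraph.fromEdgeSet
  {s(0,1), s(1,2), s(2,3), s(3,4), s(4,5), s(5,6), s(6,7), s(7,0),
   s(1,3), s(3,5), s(5,7), s(1,7)}

/-- There is a walk from `u` to `v` of length `n` whose later vertices run through `s`,
each exactly once. -/
def HasPathThrough {V : Type} [DecidableEq V] (G : SimpleGraph V) :
    ℕ → Finset V → V → V → Prop
  | 0, s, u, v => u = v ∧ s = ∅
  | n + 1, s, u, v => ∃ w ∈ s, G.Adj u w ∧ HasPathThrough G n (s.erase w) w v

instance HasPathThrough.decidable {V : Type} [DecidableEq V] (G : SimpleGraph V)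
    [DecidableRel G.Adj] :
    ∀ (n : ℕ) (s : Finset V) (u v : V), Decidable (HasPathThrough G n s u v)
  | 0, s, u, v => inferInstanceAs (Decidable (u = v ∧ s = ∅))
  | n + 1, s, u, v =>
    have := HasPathThrough.decidable G n
    inferInstanceAs (Decidable (∃ w ∈ s, G.Adj u w ∧ HasPathThrough G n (s.erase w) w v))

theorem SimpleGraph.Walk.IsPath.hasPathThrough {V : Type} [DecidableEq V] {G : SimpleGraph V}
    {u v : V} {p : G.Walk u v} (hp : p.IsPath) :
    HasPathThrough G p.length (p.support.toFinset.erase u) u v := by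
  induction p with
  | nil => simp [HasPathThrough]
  | @cons u w v h p ih =>
    obtain ⟨hp, hu⟩ := (Walk.cons_isPath_iff h p).1 hp
    have hs : (Walk.cons h p).support.toFinset.erase u = p.support.toFinset := by
      simp [hu]
    rw [hs]
    exact ⟨w, by simp, h, ih hp⟩

instance L1.decidableAdj : DecidableRel L1.Adj :=
  inferInstanceAs (DecidableRel (SimpleGraph.fromEdgeSet _).Adj)

/-- The vertices `x = w₁` and `y = w₅` are not connected by a Hamilton path
of `L⁽¹⁾`. -/
theorem no_ham_path_L1 : ¬ HamConnected L1 0 4 := by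
  rintro ⟨p, hp, hall⟩
  have hham : p.IsHamiltonian := hp.isHamiltonian_of_mem hall
  have hsupp : p.support.toFinset = Finset.univ := by
    ext v
    simp [hall v]
  have hthrough := hp.hasPathThrough
  rw [hham.length_eq, hsupp, Fintype.card_fin] at hthrough
  revert hthrough
  set_option maxRecDepth 100000 in decide
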